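/- arXiv:2210.10559 — 2 statements merged into one kernel-verified Lean document; each statement's English description precedes it below -/
import Mathlib

section
/- The kernel of ψ₀ equals the ideal of R₀ generated by the 2×2 minors of the matrix M₀. -/
open MvPolynomial

/-- The twists `(a₁, a₂, a₃, a₄) = (0, 1, 1, 2)` of the weighted scroll `𝔽(0,1,1,2)`. -/
def av : Fin 4 → ℕ := ![0, 1, 1, 2]

/-- The index set `Λ` of the 20 monomials `t₁^i t₂^j x_m x_n` with `m ≤ n` and
`i + j = a_m + a_n - 1`, spanning the half-anticanonical system of `𝔽(0,1,1,2)`. -/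
abbrev Lam : Type :=
  {q : ℕ × ℕ × Fin 4 × Fin 4 // q.2.2.1 ≤ q.2.2.2 ∧ q.1 + q.2.1 + 1 = av q.2.2.1 + av q.2.2.2}

/-- The polynomial ring `R₀ = ℂ[y_w : w ∈ Λ]` in 20 variables. -/
abbrev R0 : Type := MvPolynomial Lam ℂ

/-- The target polynomial ring `ℂ[t₁,t₂,x₁,x₂,x₃,x₄]`; variables `0,1` are `t₁,t₂`
and variables `2,3,4,5` are `x₁,x₂,x₃,x₄`. -/
abbrev T6 : Type := MvPolynomial (Fin 6) ℂ

/-- The variable `y_w` of `R₀` attached to the monomial `w = t₁^i t₂^j x_m x_n ∈ Λ`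
(and `0` if the data does not determine an element of `Λ`; all matrix entries below do). -/
noncomputable def yVar (i j : ℕ) (m n : Fin 4) : R0 :=
  if h : m ≤ n ∧ i + j + 1 = av m + av n then X ⟨(i, j, m, n), h⟩ else 0

/-- The ℂ-algebra homomorphism `ψ₀ : R₀ → ℂ[t₁,t₂,x₁,…,x₄]`, `y_w ↦ w`. -/
noncomputable def psi0 : R0 →ₐ[ℂ] T6 :=
  aeval fun w : Lam =>
    (X 0) ^ w.1.1 * (X 1) ^ w.1.2.1 *
      X (⟨(w.1.2.2.1 : ℕ) + 2, Nat.add_lt_add_right w.1.2.2.1.isLt 2⟩ : Fin 6) *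
      X (⟨(w.1.2.2.2 : ℕ) + 2, Nat.add_lt_add_right w.1.2.2.2.isLt 2⟩ : Fin 6)

/-- The row labels of `M₀` (and of `N_t`): the monomials `x₂, x₃, t₁x₄, t₂x₄`, each
recorded as `(i, j, m)` standing for `t₁^i t₂^j x_m` (with `x`-indices 0-based). -/
def rowLab : Fin 4 → ℕ × ℕ × Fin 4 := ![(0, 0, 1), (0, 0, 2), (1, 0, 3), (0, 1, 3)]

/-- The column labels of `M₀`: the monomials
`x₁, t₁x₂, t₁x₃, t₂x₂, t₂x₃, t₁²x₄, t₁t₂x₄, t₂²x₄`. -/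
def colLab : Fin 8 → ℕ × ℕ × Fin 4 :=
  ![(0, 0, 0), (1, 0, 1), (1, 0, 2), (0, 1, 1), (0, 1, 2), (2, 0, 3), (1, 1, 3), (0, 2, 3)]

/-- The `4 × 8` matrix `M₀` over `R₀`, with `(r, c)` entry the variable `y_{rc}` attached to
the product of the row label `r` and the column label `c`. -/
noncomputable def M0 : Matrix (Fin 4) (Fin 8) R0 := fun r c =>
  yVar ((rowLab r).1 + (colLab c).1) ((rowLab r).2.1 + (colLab c).2.1)
    (min (rowLab r).2.2 (colLab c).2.2) (max (rowLab r).2.2 (colLab c).2.2)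

/-- The ideal generated by the `2 × 2` minors of a matrix. -/
def minors2 {R : Type*} [CommRing R] {m n : Type*} (M : Matrix m n R) : Ideal R :=
  Ideal.span {x | ∃ i₁ i₂ j₁ j₂, x = M i₁ j₁ * M i₂ j₂ - M i₁ j₂ * M i₂ j₁}

/-- The class of the variable `y_w`, for `w = t₁^i t₂^j x_m x_n` with `m, n` in any order, modulo
the `2 × 2` minors of `M₀`. -/
noncomputable def yClass (i j : ℕ) (m n : Fin 4) : R0 ⧸ minors2 M0 :=
  Ideal.Quotient.mk _ (yVar i j (min m n) (max m n))

/-- The element of `Λ` given by `t₁^i t₂^j x_m x_n`, with `m, n` in any order. -/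
def lamOf (i j : ℕ) (m n : Fin 4) (h : i + j + 1 = av m + av n) : Lam :=
  ⟨(i, j, min m n, max m n), min_le_max, by
    rcases le_total m n with hmn | hmn <;> simp [hmn] <;> omega⟩

/-- The class of the variable `y_w` modulo the `2 × 2` minors of `M₀`. -/
noncomputable def lamClass (w : Lam) : R0 ⧸ minors2 M0 := Ideal.Quotient.mk _ (X w)

/-- The exponent vector of `w ∈ Λ`, regarded as a monomial in `t₁,t₂,x₁,…,x₄`. -/
noncomputable def lamExp (w : Lam) : Fin 6 →₀ ℕ :=
  Finsupp.single 0 w.1.1 + Finsupp.single 1 w.1.2.1 +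
    Finsupp.single (w.1.2.2.1.addNat 2) 1 + Finsupp.single (w.1.2.2.2.addNat 2) 1

/-- The class of a monomial in the variables `y_w` modulo the `2 × 2` minors of `M₀`. -/
noncomputable def monClass (s : Multiset Lam) : R0 ⧸ minors2 M0 := (s.map lamClass).prod

/-- The exponent vector of the image under `ψ₀` of a monomial in the variables `y_w`. -/
noncomputable def monExp (s : Multiset Lam) : Fin 6 →₀ ℕ := (s.map lamExp).sum

/-- A linear order on `Λ`: lexicographic in `(m, n, j)`. -/
def lamRank (w : Lam) : ℕ := 100 * w.1.2.2.1 + 10 * w.1.2.2.2 + w.1.2.1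

theorem yClass_comm (i j : ℕ) (m n : Fin 4) : yClass i j m n = yClass i j n m := by
  rw [yClass, yClass, min_comm, max_comm]

theorem lamClass_lamOf (i j : ℕ) (m n : Fin 4) (h : i + j + 1 = av m + av n) :
    lamClass (lamOf i j m n h) = yClass i j m n := by
  have := (lamOf i j m n h).2
  simp only [lamOf] at this
  rw [lamClass, yClass, yVar, dif_pos this]
  rfl

theorem lamExp_lamOf (i j : ℕ) (m n : Fin 4) (h : i + j + 1 = av m + av n) :
    lamExp (lamOf i j m n h) = Finsupp.single 0 i + Finsupp.single 1 j +
      Finsupp.single (m.addNat 2) 1 + Finsupp.single (n.addNat 2) 1 := by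
  rcases le_total m n with hmn | hmn <;> simp only [lamExp, lamOf, hmn, min_eq_left, max_eq_right,
    min_eq_right, max_eq_left]
  exact add_right_comm _ _ _

theorem exists_eq_lamOf (w : Lam) : ∃ i j m n h, m ≤ n ∧ w = lamOf i j m n h :=
  ⟨_, _, _, _, w.2.2, w.2.1, by simp [lamOf, w.2.1]⟩

theorem lamRank_lamOf {i j : ℕ} {m n : Fin 4} (h : i + j + 1 = av m + av n) (hmn : m ≤ n) :
    lamRank (lamOf i j m n h) = 100 * m + 10 * n + j := by
  simp only [lamRank, lamOf, min_eq_left hmn, max_eq_right hmn]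

theorem lamOf_comm (i j : ℕ) (m n : Fin 4) (h : i + j + 1 = av m + av n) :
    lamOf i j m n h = lamOf i j n m (by omega) := by
  simp [lamOf, min_comm, max_comm]

theorem av_le_two (m : Fin 4) : av m ≤ 2 := by revert m; decide

theorem exists_rowLab {i j : ℕ} {m : Fin 4} (h : i + j + 1 = av m) :
    ∃ r, rowLab r = (i, j, m) := by
  have hi : i < 2 := by have := av_le_two m; omega
  have hj : j < 2 := by have := av_le_two m; omega
  revert m
  interval_cases i <;> interval_cases j <;> decide

theorem exists_colLab {i j : ℕ} {m : Fin 4} (h : i + j = av m) :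
    ∃ c, colLab c = (i, j, m) := by
  have hi : i < 3 := by have := av_le_two m; omega
  have hj : j < 3 := by have := av_le_two m; omega
  revert m
  interval_cases i <;> interval_cases j <;> decide

/-- The relation given by a `2 × 2` minor with rows `t₁^i₁ t₂^j₁ x_a`, `t₁^i₂ t₂^j₂ x_b` and columns
`t₁^k₁ t₂^l₁ x_c`, `t₁^k₂ t₂^l₂ x_d`. -/
theorem yClass_minor {i₁ j₁ i₂ j₂ k₁ l₁ k₂ l₂ : ℕ} {a b c d : Fin 4} (ha : i₁ + j₁ + 1 = av a)
    (hb : i₂ + j₂ + 1 = av b) (hc : k₁ + l₁ = av c) (hd : k₂ + l₂ = av d) :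
    yClass (i₁ + k₁) (j₁ + l₁) a c * yClass (i₂ + k₂) (j₂ + l₂) b d =
      yClass (i₁ + k₂) (j₁ + l₂) a d * yClass (i₂ + k₁) (j₂ + l₁) b c := by
  obtain ⟨r₁, hr₁⟩ := exists_rowLab ha
  obtain ⟨r₂, hr₂⟩ := exists_rowLab hb
  obtain ⟨c₁, hc₁⟩ := exists_colLab hc
  obtain ⟨c₂, hc₂⟩ := exists_colLab hd
  simp only [yClass, ← map_mul]
  rw [Ideal.Quotient.eq]
  refine Ideal.subset_span ⟨r₁, r₂, c₁, c₂, ?_⟩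
  simp [M0, hr₁, hr₂, hc₁, hc₂]

theorem exists_split {i j p q : ℕ} (h : i + j = p + q) :
    ∃ i₁ j₁ i₂ j₂, i = i₁ + i₂ ∧ j = j₁ + j₂ ∧ i₁ + j₁ = p ∧ i₂ + j₂ = q :=
  ⟨min i p, p - min i p, i - min i p, j - (p - min i p), by omega, by omega, by omega, by omega⟩

/-- Exchanging a variable `x_b` against `x_c` with `c ∈ {2, 3}`. -/
theorem yClass_exchange_x {i j k l : ℕ} {a b c d : Fin 4} (h : i + j + 1 = av a + av b)
    (hb : 1 ≤ av b) (h' : k + l + 1 = av c + av d) (hc : av c = 1) :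
    ∃ i₁ j₁ i₂ j₂, i = i₁ + i₂ ∧ j = j₁ + j₂ ∧ i₂ + j₂ + 1 = av a + av c ∧
      yClass i j a b * yClass k l c d = yClass i₂ j₂ a c * yClass (i₁ + k) (j₁ + l) b d := by
  obtain ⟨i₁, j₁, i₂, j₂, rfl, rfl, h₁, h₂⟩ :=
    exists_split (show i + j = (av b - 1) + av a by omega)
  refine ⟨i₁, j₁, i₂, j₂, rfl, rfl, by omega, ?_⟩
  have := yClass_minor (i₁ := i₁) (j₁ := j₁) (i₂ := 0) (j₂ := 0) (k₁ := i₂) (l₁ := j₂) (k₂ := k)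
    (l₂ := l) (a := b) (b := c) (c := a) (d := d) (by omega) (by omega) h₂ (by omega)
  simp only [zero_add] at this
  rw [yClass_comm _ _ a b, this, mul_comm, yClass_comm _ _ c a]

/-- Exchanging `t₂` against `t₁` when both monomials are divisible by `x₄`. -/
theorem yClass_exchange_t_of_two_two {i j k l : ℕ} {a b c d : Fin 4}
    (h : i + (j + 1) + 1 = av a + av b) (h' : (k + 1) + l + 1 = av c + av d)
    (hb : av b = 2) (hd : av d = 2) :
    yClass i (j + 1) a b * yClass (k + 1) l c d = yClass (i + 1) j a b * yClass k (l + 1) c d := by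
  have := yClass_minor (i₁ := 0) (j₁ := 1) (i₂ := 1) (j₂ := 0) (k₁ := i) (l₁ := j) (k₂ := k)
    (l₂ := l) (a := b) (b := d) (c := a) (d := c) (by omega) (by omega) (by omega) (by omega)
  have hav : ∀ b d : Fin 4, av b = 2 → av d = 2 → b = d := by decide
  have hbd := hav b d hb hd
  subst hbd
  simp only [zero_add, add_comm 1] at this
  rw [yClass_comm _ _ a, yClass_comm _ _ c, this, yClass_comm _ _ a, yClass_comm _ _ c, mul_comm]

/-- Exchanging `t₂` against `t₁` when only the first monomial is divisible by `x₄`. -/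
theorem yClass_exchange_t_of_two_one {i j k l : ℕ} {a b c d : Fin 4}
    (h : i + (j + 1) + 1 = av a + av b) (h' : (k + 1) + l + 1 = av c + av d)
    (hb : av b = 2) (hc : av c = 1) (hd : av d = 1) :
    yClass i (j + 1) a b * yClass (k + 1) l c d = yClass (i + 1) j a b * yClass k (l + 1) c d := by
  obtain ⟨rfl, rfl⟩ : k = 0 ∧ l = 0 := by omega
  have e₁ := yClass_minor (i₁ := 0) (j₁ := 1) (i₂ := 0) (j₂ := 0) (k₁ := i) (l₁ := j) (k₂ := 1)
    (l₂ := 0) (a := b) (b := c) (c := a) (d := d) (by omega) (by omega) (by omega) (by omega)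
  have e₂ := yClass_minor (i₁ := 1) (j₁ := 0) (i₂ := 0) (j₂ := 0) (k₁ := i) (l₁ := j) (k₂ := 0)
    (l₂ := 1) (a := b) (b := c) (c := a) (d := d) (by omega) (by omega) (by omega) (by omega)
  simp only [zero_add, add_zero, add_comm 1] at e₁ e₂ ⊢
  rw [yClass_comm _ _ a, e₁, yClass_comm _ _ a, e₂]

/-- Exchanging `t₂` against `t₁` when only the second monomial is divisible by `x₄`. -/
theorem yClass_exchange_t_of_one_two {i j k l : ℕ} {a b c d : Fin 4}
    (h : i + (j + 1) + 1 = av a + av b) (h' : (k + 1) + l + 1 = av c + av d)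
    (ha : av a = 1) (hb : av b = 1) (hd : av d = 2) :
    yClass i (j + 1) a b * yClass (k + 1) l c d = yClass (i + 1) j a b * yClass k (l + 1) c d := by
  rw [mul_comm, mul_comm (yClass (i + 1) j a b)]
  exact (yClass_exchange_t_of_two_one (i := k) (j := l) (k := i) (l := j) (by omega) (by omega)
    hd ha hb).symm

/-- Exchanging `t₂` against `t₁` when neither monomial is divisible by `x₄`. -/
theorem yClass_exchange_t_of_one_one {i j k l : ℕ} {a b c d : Fin 4}
    (h : i + (j + 1) + 1 = av a + av b) (h' : (k + 1) + l + 1 = av c + av d)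
    (ha : av a = 1) (hb : av b = 1) (hc : av c = 1) (hd : av d = 1) :
    yClass i (j + 1) a b * yClass (k + 1) l c d = yClass (i + 1) j a b * yClass k (l + 1) c d := by
  obtain ⟨rfl, rfl⟩ : k = 0 ∧ l = 0 := by omega
  obtain ⟨rfl, rfl⟩ : i = 0 ∧ j = 0 := by omega
  have e₁ := yClass_minor (i₁ := 0) (j₁ := 0) (i₂ := 0) (j₂ := 0) (k₁ := 0) (l₁ := 1) (k₂ := 1)
    (l₂ := 0) (a := b) (b := c) (c := a) (d := d) (by omega) (by omega) (by omega) (by omega)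
  have e₂ := yClass_minor (i₁ := 0) (j₁ := 0) (i₂ := 0) (j₂ := 0) (k₁ := 1) (l₁ := 0) (k₂ := 0)
    (l₂ := 1) (a := d) (b := a) (c := b) (d := c) (by omega) (by omega) (by omega) (by omega)
  simp only [zero_add] at e₁ e₂ ⊢
  rw [yClass_comm _ _ a, e₁, yClass_comm _ _ b, yClass_comm _ _ c a, e₂, mul_comm,
    yClass_comm _ _ d]

/-- Exchanging a factor `t₂` of one monomial against a factor `t₁` of another one. -/
theorem yClass_exchange_t {i j k l : ℕ} {a b c d : Fin 4}
    (h : i + (j + 1) + 1 = av a + av b) (h' : (k + 1) + l + 1 = av c + av d) :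
    yClass i (j + 1) a b * yClass (k + 1) l c d = yClass (i + 1) j a b * yClass k (l + 1) c d := by
  wlog hab : av a ≤ av b generalizing a b
  · rw [yClass_comm _ _ a, yClass_comm _ _ a]
    exact this (by omega) (by omega)
  wlog hcd : av c ≤ av d generalizing c d
  · rw [yClass_comm _ _ c, yClass_comm _ _ c]
    exact this (by omega) (by omega)
  have hb := av_le_two b
  have hd := av_le_two d
  rcases eq_or_ne (av b) 2 with hb2 | hb2 <;> rcases eq_or_ne (av d) 2 with hd2 | hd2
  · exact yClass_exchange_t_of_two_two h h' hb2 hd2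
  · exact yClass_exchange_t_of_two_one h h' hb2 (by omega) (by omega)
  · exact yClass_exchange_t_of_one_two h h' (by omega) (by omega) hd2
  · exact yClass_exchange_t_of_one_one h h' (by omega) (by omega) (by omega) (by omega)

theorem monClass_cons (w : Lam) (s : Multiset Lam) :
    monClass (w ::ₘ s) = lamClass w * monClass s := by simp [monClass]

theorem monExp_cons (w : Lam) (s : Multiset Lam) :
    monExp (w ::ₘ s) = lamExp w + monExp s := by simp [monExp]

theorem lamExp_lamOf_zero {i j : ℕ} {m n : Fin 4} (h : i + j + 1 = av m + av n) :
    lamExp (lamOf i j m n h) 0 = i := by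
  have h : ∀ c : Fin 4, c.addNat 2 ≠ (0 : Fin 6) := by decide
  simp [lamExp_lamOf, h]

theorem lamExp_lamOf_addNat {i j : ℕ} {m n : Fin 4} (h : i + j + 1 = av m + av n) (c : Fin 4) :
    lamExp (lamOf i j m n h) (c.addNat 2) = (if m = c then 1 else 0) + (if n = c then 1 else 0) := by
  have h₀ : ∀ c : Fin 4, (0 : Fin 6) ≠ c.addNat 2 := by decide
  have h₁ : ∀ c : Fin 4, (1 : Fin 6) ≠ c.addNat 2 := by decide
  have h₂ : ∀ a c : Fin 4, a.addNat 2 = c.addNat 2 ↔ a = c := by decide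
  simp only [lamExp_lamOf, Finsupp.add_apply, Finsupp.single_apply, h₀, h₁, h₂, if_false, zero_add]

theorem exists_mem_of_lamExp_lt {s : Multiset Lam} {w w' : Lam} {v : Fin 6}
    (hle : lamExp w' ≤ monExp (w ::ₘ s)) (hlt : lamExp w v < lamExp w' v) :
    ∃ z ∈ s, lamExp z v ≠ 0 := by
  by_contra! hz
  have hs : monExp s v = 0 := by
    clear hle
    induction s using Multiset.induction_on with
    | empty => simp [monExp]
    | cons z s ih =>
      rw [monExp_cons, Finsupp.add_apply, hz z (by simp),
        ih fun x hx => hz x (Multiset.mem_cons_of_mem hx)]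
  have := hle v
  rw [monExp_cons, Finsupp.add_apply] at this
  omega

theorem exists_lamOf_of_lamExp_ne_zero {w : Lam} {c : Fin 4} (h : lamExp w (c.addNat 2) ≠ 0) :
    ∃ i j d h, w = lamOf i j c d h := by
  obtain ⟨i, j, m, n, hw, -, rfl⟩ := exists_eq_lamOf w
  rw [lamExp_lamOf_addNat] at h
  by_cases h₁ : m = c
  · subst h₁
    exact ⟨_, _, _, _, rfl⟩
  by_cases h₂ : n = c
  · subst h₂
    exact ⟨_, _, _, _, lamOf_comm ..⟩
  · simp [h₁, h₂] at h

theorem lamRank_injective : Function.Injective lamRank := by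
  intro w z h
  obtain ⟨⟨i, j, m, n⟩, hw, hw'⟩ := w
  obtain ⟨⟨i', j', m', n'⟩, hz, hz'⟩ := z
  simp only [lamRank] at h hw' hz'
  have := av_le_two m
  have := av_le_two n
  have := av_le_two m'
  have := av_le_two n'
  have hm : m = m' := by omega
  have hn : n = n' := by omega
  subst hm hn
  have hj : j = j' := by omega
  have hi : i = i' := by omega
  subst hi hj
  rfl

/-- If a monomial has a factor `w` and its image is divisible by some `w' ∈ Λ` of smaller rank,
then modulo the minors it is congruent to a monomial having a factor of smaller rank than `w`. -/
theorem exists_lamRank_lt {s : Multiset Lam} {w w' : Lam} (hle : lamExp w' ≤ monExp (w ::ₘ s))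
    (hlt : lamRank w' < lamRank w) :
    ∃ z t, monClass (z ::ₘ t) = monClass (w ::ₘ s) ∧ monExp (z ::ₘ t) = monExp (w ::ₘ s) ∧
      lamRank z < lamRank w := by
  obtain ⟨i, j, m, n, hw, hmn, rfl⟩ := exists_eq_lamOf w
  obtain ⟨i', j', m', n', hw', hmn', rfl⟩ := exists_eq_lamOf w'
  rw [lamRank_lamOf hw hmn] at hlt ⊢
  rw [lamRank_lamOf hw' hmn'] at hlt
  have := av_le_two m
  have := av_le_two n
  have := av_le_two m'
  have := av_le_two n'
  rcases lt_trichotomy m m' with hmm | rfl | hmm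
  · omega
  · rcases lt_trichotomy n n' with hnn | rfl | hnn
    · omega
    · obtain ⟨z, hz, hz0⟩ := exists_mem_of_lamExp_lt (v := 0) hle (by
        rw [lamExp_lamOf_zero, lamExp_lamOf_zero]
        omega)
      obtain ⟨t, rfl⟩ := Multiset.exists_cons_of_mem hz
      obtain ⟨k, l, c, d, hcd, -, rfl⟩ := exists_eq_lamOf z
      rw [lamExp_lamOf_zero] at hz0
      obtain ⟨k, rfl⟩ := Nat.exists_eq_add_one_of_ne_zero hz0
      obtain ⟨j, rfl⟩ := Nat.exists_eq_add_one_of_ne_zero (show j ≠ 0 by omega)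
      refine ⟨lamOf (i + 1) j m n (by omega), lamOf k (l + 1) c d (by omega) ::ₘ t, ?_, ?_, ?_⟩
      · simp only [monClass_cons, lamClass_lamOf, ← mul_assoc]
        rw [yClass_exchange_t hw hcd]
      · simp only [monExp_cons, lamExp_lamOf, Finsupp.single_add]
        abel
      · rw [lamRank_lamOf _ hmn]
        omega
    · obtain ⟨z, hz, hz0⟩ := exists_mem_of_lamExp_lt (v := n'.addNat 2) hle (by
        rw [lamExp_lamOf_addNat, lamExp_lamOf_addNat, if_neg hnn.ne', if_pos rfl]
        omega)
      obtain ⟨t, rfl⟩ := Multiset.exists_cons_of_mem hz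
      obtain ⟨k, l, d, hd, rfl⟩ := exists_lamOf_of_lamExp_ne_zero hz0
      have hav : ∀ a b c : Fin 4, c < b → a ≤ c → 1 ≤ av a + av c → 1 ≤ av b ∧ av c = 1 := by
        decide
      obtain ⟨h₁, h₂⟩ := hav m n n' hnn hmn' (by omega)
      obtain ⟨i₁, j₁, i₂, j₂, rfl, rfl, h₃, h₄⟩ := yClass_exchange_x hw h₁ hd h₂
      refine ⟨lamOf i₂ j₂ m n' h₃, lamOf (i₁ + k) (j₁ + l) n d (by omega) ::ₘ t, ?_, ?_, ?_⟩
      · simp only [monClass_cons, lamClass_lamOf, ← mul_assoc]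
        rw [h₄]
      · simp only [monExp_cons, lamExp_lamOf, Finsupp.single_add]
        abel
      · rw [lamRank_lamOf _ hmn']
        omega
  · obtain ⟨z, hz, hz0⟩ := exists_mem_of_lamExp_lt (v := m'.addNat 2) hle (by
      rw [lamExp_lamOf_addNat, lamExp_lamOf_addNat, if_neg hmm.ne', if_neg (hmm.trans_le hmn).ne',
        if_pos rfl]
      omega)
    obtain ⟨t, rfl⟩ := Multiset.exists_cons_of_mem hz
    refine ⟨z, lamOf i j m n hw ::ₘ t, by rw [Multiset.cons_swap], by rw [Multiset.cons_swap], ?_⟩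
    obtain ⟨k, l, c, d, hcd, hle', rfl⟩ := exists_eq_lamOf z
    have hc : c ≤ m' := by
      by_contra! hlt'
      rw [lamExp_lamOf_addNat, if_neg hlt'.ne', if_neg (hlt'.trans_le hle').ne'] at hz0
      exact hz0 rfl
    have := av_le_two c
    have := av_le_two d
    rw [lamRank_lamOf _ hle']
    omega

/-- A nonempty monomial is congruent to one having a factor of the least rank among all
elements of `Λ` dividing its image. -/
theorem exists_minimal_factor {s : Multiset Lam} (hs : s ≠ 0) :
    ∃ w t, monClass (w ::ₘ t) = monClass s ∧ monExp (w ::ₘ t) = monExp s ∧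
      ∀ w', lamExp w' ≤ monExp s → lamRank w ≤ lamRank w' := by
  classical
  have hex : ∃ k w t, monClass (w ::ₘ t) = monClass s ∧ monExp (w ::ₘ t) = monExp s ∧
      lamRank w = k := by
    obtain ⟨w, hw⟩ := Multiset.exists_mem_of_ne_zero hs
    obtain ⟨t, rfl⟩ := Multiset.exists_cons_of_mem hw
    exact ⟨_, w, t, rfl, rfl, rfl⟩
  obtain ⟨w, t, h₁, h₂, h₃⟩ := Nat.find_spec hex
  refine ⟨w, t, h₁, h₂, fun w' hw' => ?_⟩
  by_contra! hlt
  obtain ⟨z, t', h₄, h₅, h₆⟩ := exists_lamRank_lt (h₂ ▸ hw') hlt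
  rw [h₃] at h₆
  exact Nat.find_min hex h₆ ⟨z, t', h₄.trans h₁, h₅.trans h₂, rfl⟩

theorem degree_lamExp_pos (w : Lam) : 0 < (lamExp w).degree := by
  simp [lamExp, map_add]

theorem eq_zero_of_monExp_eq_zero {s : Multiset Lam} (h : monExp s = 0) : s = 0 := by
  by_contra hs
  obtain ⟨w, hw⟩ := Multiset.exists_mem_of_ne_zero hs
  obtain ⟨t, rfl⟩ := Multiset.exists_cons_of_mem hw
  have := congrArg Finsupp.degree h
  have := degree_lamExp_pos w
  rw [monExp_cons] at *
  simp only [map_add, map_zero] at *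
  omega

/-- Monomials with the same image under `ψ₀` are congruent modulo the minors. -/
theorem monClass_eq_of_monExp_eq {s s' : Multiset Lam} (h : monExp s = monExp s') :
    monClass s = monClass s' := by
  induction hd : (monExp s).degree using Nat.strong_induction_on generalizing s s' with
  | _ d ih =>
  by_cases hs : s = 0
  · subst hs
    rw [eq_zero_of_monExp_eq_zero (s := s') (by rw [← h]; simp [monExp])]
  have hs' : s' ≠ 0 := by
    rintro rfl
    exact hs (eq_zero_of_monExp_eq_zero (by rw [h]; simp [monExp]))
  obtain ⟨w, t, h₁, h₂, h₃⟩ := exists_minimal_factor hs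
  obtain ⟨w', t', h₁', h₂', h₃'⟩ := exists_minimal_factor hs'
  obtain rfl : w = w' := lamRank_injective <| le_antisymm
    (h₃ w' (by rw [h, ← h₂', monExp_cons]; exact le_self_add))
    (h₃' w (by rw [← h, ← h₂, monExp_cons]; exact le_self_add))
  have ht : monExp t = monExp t' := by
    rw [← h₂, ← h₂', monExp_cons, monExp_cons] at h
    exact add_left_cancel h
  rw [← h₁, ← h₁', monClass_cons, monClass_cons, ih _ ?_ ht rfl]
  have := degree_lamExp_pos w
  rw [← hd, ← h₂, monExp_cons, map_add]
  omega

theorem psi0_X (w : Lam) : psi0 (X w) = monomial (lamExp w) 1 := by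
  rw [psi0, aeval_X, lamExp]
  simp only [X_pow_eq_monomial]
  simp only [X, monomial_mul, mul_one]
  rfl

theorem psi0_monomial (e : Lam →₀ ℕ) :
    psi0 (monomial e 1) = monomial (monExp (Finsupp.toMultiset e)) 1 := by
  induction e using Finsupp.induction_linear with
  | zero => simp [monExp]
  | add f g hf hg =>
    rw [← mul_one (1 : ℂ), ← monomial_mul, map_mul, hf, hg, monomial_mul, map_add]
    simp [monExp]
  | single w n =>
    rw [← X_pow_eq_monomial, map_pow, psi0_X, monomial_pow, Finsupp.toMultiset_single]
    simp [monExp, Multiset.map_nsmul, Multiset.sum_nsmul]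

theorem mk_monomial (e : Lam →₀ ℕ) :
    Ideal.Quotient.mk (minors2 M0) (monomial e 1) = monClass (Finsupp.toMultiset e) := by
  induction e using Finsupp.induction_linear with
  | zero => simp [monClass]
  | add f g hf hg =>
    rw [← mul_one (1 : ℂ), ← monomial_mul, map_mul, hf, hg, map_add]
    simp [monClass]
  | single w n =>
    rw [← X_pow_eq_monomial, map_pow, Finsupp.toMultiset_single]
    simp [monClass, lamClass, Multiset.map_nsmul, Multiset.prod_nsmul]

/-- The quotient map by the minors factors `ℂ`-linearly through `ψ₀`. -/
theorem exists_linear_factorization :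
    ∃ σ : T6 →ₗ[ℂ] R0 ⧸ minors2 M0, ∀ f, σ (psi0 f) = Ideal.Quotient.mk (minors2 M0) f := by
  classical
  let σ : T6 →ₗ[ℂ] R0 ⧸ minors2 M0 := (basisMonomials (Fin 6) ℂ).constr ℂ fun u =>
    if h : ∃ s, monExp s = u then monClass h.choose else 0
  refine ⟨σ, fun f => ?_⟩
  have key : σ ∘ₗ psi0.toLinearMap = (Ideal.Quotient.mkₐ ℂ (minors2 M0)).toLinearMap := by
    refine (basisMonomials Lam ℂ).ext fun e => ?_
    have hex : ∃ s, monExp s = monExp (Finsupp.toMultiset e) := ⟨_, rfl⟩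
    have hσ := (basisMonomials (Fin 6) ℂ).constr_basis ℂ
      (fun u => if h : ∃ s, monExp s = u then monClass h.choose else 0)
      (monExp (Finsupp.toMultiset e))
    rw [coe_basisMonomials, dif_pos hex] at hσ
    simp only [coe_basisMonomials, LinearMap.comp_apply, AlgHom.toLinearMap_apply, psi0_monomial,
      Ideal.Quotient.mkₐ_eq_mk, mk_monomial]
    exact hσ.trans (monClass_eq_of_monExp_eq hex.choose_spec)
  exact LinearMap.congr_fun key f

/-- The image under `ψ₀` of an entry of `M₀` is the product of its row and column labels. -/
theorem psi0_M0 (r : Fin 4) (c : Fin 8) :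
    psi0 (M0 r c) =
      (X 0 ^ (rowLab r).1 * X 1 ^ (rowLab r).2.1 * X ((rowLab r).2.2.addNat 2)) *
        (X 0 ^ (colLab c).1 * X 1 ^ (colLab c).2.1 * X ((colLab c).2.2.addNat 2)) := by
  have hr : ∀ r, (rowLab r).1 + (rowLab r).2.1 + 1 = av (rowLab r).2.2 := by decide
  have hc : ∀ c, (colLab c).1 + (colLab c).2.1 = av (colLab c).2.2 := by decide
  have hr := hr r
  have hc := hc c
  rw [M0]
  generalize rowLab r = p at *
  generalize colLab c = q at *
  obtain ⟨i, j, m⟩ := p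
  obtain ⟨k, l, n⟩ := q
  dsimp only at *
  have h : i + k + (j + l) + 1 = av m + av n := by omega
  have hX : yVar (i + k) (j + l) (min m n) (max m n) = X (lamOf (i + k) (j + l) m n h) :=
    dif_pos (lamOf (i + k) (j + l) m n h).2
  rw [hX, psi0_X, lamExp_lamOf]
  simp only [X_pow_eq_monomial]
  simp only [X, monomial_mul, mul_one, Finsupp.single_add]
  congr 2
  abel

/-- The kernel of `ψ₀` equals the ideal of `R₀` generated by the
`2 × 2` minors of `M₀`: the closure `Q ⊂ ℙ¹⁹` of the image of the half-anticanonical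
rational map `φ₀ : 𝔽(0,1,1,2) ⇢ ℙ¹⁹` is cut out scheme-theoretically by the
`2 × 2` minors of `M₀`. -/
theorem ker_psi0_eq_minors : RingHom.ker psi0.toRingHom = minors2 M0 := by
  apply le_antisymm
  · intro f hf
    obtain ⟨σ, hσ⟩ := exists_linear_factorization
    have hf : psi0 f = 0 := hf
    rw [← Ideal.Quotient.eq_zero_iff_mem, ← hσ, hf, map_zero]
  · refine Ideal.span_le.2 ?_
    rintro _ ⟨i₁, i₂, j₁, j₂, rfl⟩
    change psi0 _ = 0
    simp only [map_sub, map_mul, psi0_M0]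
    ring
end

section
/- The ideal of R₀ generated by the 2×2 minors of M₀ is a prime ideal, and the quotient ring R₀ / (2×2 minors of M₀) has Krull dimension 5. -/
open MvPolynomial

theorem ringKrullDim_eq_of_isIntegral (R S : Type*) [CommRing R] [CommRing S] [Algebra R S]
    [Algebra.IsIntegral R S] [FaithfulSMul R S] : ringKrullDim R = ringKrullDim S := by
  apply le_antisymm
  · refine iSup_le fun l => ?_
    obtain ⟨Q, -, hQ, hQl⟩ := Ideal.exists_ideal_over_prime_of_isIntegral (S := S)
      l.head.asIdeal ⊥
      (by simp [← RingHom.ker_eq_comap_bot,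
        (RingHom.injective_iff_ker_eq_bot _).mp (FaithfulSMul.algebraMap_injective R S)])
    have : Q.LiesOver l.head.asIdeal := ⟨hQl.symm⟩
    obtain ⟨L, hL, -⟩ := Ideal.exists_ltSeries_of_hasGoingUp l Q
    rw [← hL]
    exact Order.LTSeries.length_le_krullDim L
  · exact Order.krullDim_le_of_strictMono (PrimeSpectrum.comap (algebraMap R S))
      fun I J h => Ideal.IsIntegral.comap_lt_comap h

theorem ringKrullDim_eq_of_trdeg_eq (k A : Type*) [Field k] [CommRing A] [IsDomain A] [Algebra k A]
    [Algebra.FiniteType k A] {n : ℕ} (h : Algebra.trdeg k A = n) : ringKrullDim A = n := by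
  obtain ⟨s, g, hg, hint⟩ := exists_integral_inj_algHom_of_fg k A
  algebraize [g.toRingHom]
  have : Algebra.IsIntegral (MvPolynomial (Fin s) k) A := ⟨hint⟩
  have : FaithfulSMul (MvPolynomial (Fin s) k) A :=
    (faithfulSMul_iff_algebraMap_injective _ _).mpr hg
  have : IsScalarTower k (MvPolynomial (Fin s) k) A :=
    IsScalarTower.of_algebraMap_eq fun x => (g.commutes x).symm
  have htr := lift_trdeg_add_eq k (MvPolynomial (Fin s) k) A
  rw [trdeg_eq_zero (R := MvPolynomial (Fin s) k), h, MvPolynomial.trdeg_of_isDomain] at htr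
  have hs : s = n := by simpa using htr
  rw [← ringKrullDim_eq_of_isIntegral (MvPolynomial (Fin s) k) A]
  simp [hs]

/-- The element of `Λ` labelling the `(r, c)` entry of `M₀`. -/
def entryLabel (r : Fin 4) (c : Fin 8) : Lam :=
  ⟨((rowLab r).1 + (colLab c).1, (rowLab r).2.1 + (colLab c).2.1,
    min (rowLab r).2.2 (colLab c).2.2, max (rowLab r).2.2 (colLab c).2.2), by
      revert r c; decide⟩

theorem M0_apply (r : Fin 4) (c : Fin 8) : M0 r c = X (entryLabel r c) :=
  dif_pos (entryLabel r c).2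

/-- The columns of `M₀`: `none` is the column `x₁` and `some (i, q)` is the column obtained by
multiplying the label of row `q` by `t₁` (if `i = 0`) or `t₂` (if `i = 1`). -/
def colIndex : Option (Fin 2 × Fin 4) → Fin 8
  | none => 0
  | some (i, q) => ![![1, 2, 5, 6], ![3, 4, 6, 7]] i q

/-- A position in `M₀`, with the column given as in `colIndex`. -/
abbrev Pos : Type := Fin 4 × Option (Fin 2 × Fin 4)

/-- The variable at a position of `M₀`. -/
noncomputable def posVar (e : Pos) : R0 := M0 e.1 (colIndex e.2)

theorem exists_posVar_eq (w : Lam) : ∃ e, posVar e = X w := by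
  obtain ⟨⟨i, j, m, n⟩, hmn, hij⟩ := w
  have hav : ∀ m, av m ≤ 2 := by decide
  have hm := hav m
  have hn := hav n
  have key : ∀ i : Fin 4, ∀ j : Fin 4, ∀ m n : Fin 4,
      m ≤ n ∧ i.1 + j.1 + 1 = av m + av n →
      ∃ r : Fin 4, ∃ c, (entryLabel r (colIndex c)).1 = (i.1, j.1, m, n) := by decide +kernel
  obtain ⟨r, c, h⟩ := key ⟨i, by dsimp only at hij; omega⟩ ⟨j, by dsimp only at hij; omega⟩
    m n ⟨hmn, hij⟩
  exact ⟨(r, c), by rw [posVar, M0_apply]; exact congrArg X (Subtype.ext h)⟩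

theorem posVar_symm (r q : Fin 4) (i : Fin 2) :
    posVar (r, some (i, q)) = posVar (q, some (i, r)) := by
  simp only [posVar, M0_apply]
  have : ∀ (r q : Fin 4) (i : Fin 2), entryLabel r (colIndex (some (i, q))) =
    entryLabel q (colIndex (some (i, r))) := by decide
  exact congrArg X (this r q i)

theorem posVar_two_one (q : Fin 4) : posVar (2, some (1, q)) = posVar (3, some (0, q)) := by
  simp only [posVar, M0_apply]
  have : ∀ q : Fin 4, entryLabel 2 (colIndex (some (1, q))) =
    entryLabel 3 (colIndex (some (0, q))) := by decide
  exact congrArg X (this q)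

/-- The product of the variables at a multiset of positions, modulo the minors of `M₀`. -/
noncomputable def posProd (s : Multiset Pos) : R0 ⧸ minors2 M0 :=
  (s.map fun e => Ideal.Quotient.mk _ (posVar e)).prod

@[simp]
theorem posProd_cons (e : Pos) (s : Multiset Pos) :
    posProd (e ::ₘ s) = Ideal.Quotient.mk _ (posVar e) * posProd s := by
  simp [posProd]

theorem mk_posVar_mul_swap (r r' : Fin 4) (c c' : Option (Fin 2 × Fin 4)) :
    (Ideal.Quotient.mk (minors2 M0) (posVar (r, c)) * Ideal.Quotient.mk _ (posVar (r', c'))) =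
      Ideal.Quotient.mk _ (posVar (r', c)) * Ideal.Quotient.mk _ (posVar (r, c')) := by
  rw [← map_mul, ← map_mul, Ideal.Quotient.eq]
  exact Ideal.subset_span ⟨r, r', colIndex c, colIndex c', by simp only [posVar]; ring⟩

/-- The row labels dividing the entry at a position. -/
def posRows : Pos → Multiset (Fin 4)
  | (r, none) => {r}
  | (r, some (_, q)) => {r, q}

/-- The row labels dividing the entries at a multiset of positions. -/
def rowsOf (s : Multiset Pos) : Multiset (Fin 4) := s.bind posRows

/-- For each position, the variable `t₁` or `t₂` multiplying the label of the column, or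
`none` for the column `x₁`. -/
def twistsOf (s : Multiset Pos) : Multiset (Option (Fin 2)) := s.map fun e => e.2.map Prod.fst

@[simp]
theorem rowsOf_cons (e : Pos) (s : Multiset Pos) : rowsOf (e ::ₘ s) = posRows e + rowsOf s :=
  Multiset.cons_bind ..

@[simp]
theorem twistsOf_cons (e : Pos) (s : Multiset Pos) :
    twistsOf (e ::ₘ s) = e.2.map Prod.fst ::ₘ twistsOf s :=
  Multiset.map_cons ..

/-- Two multisets of positions are equivalent if they have the same product modulo the minors,
the same rows and the same twists. -/
structure PosEquiv (s t : Multiset Pos) : Prop where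
  prod : posProd s = posProd t
  rows : rowsOf s = rowsOf t
  twists : twistsOf s = twistsOf t

namespace PosEquiv

theorem refl (s : Multiset Pos) : PosEquiv s s := ⟨rfl, rfl, rfl⟩

theorem trans {s t u : Multiset Pos} (h : PosEquiv s t) (h' : PosEquiv t u) : PosEquiv s u :=
  ⟨h.1.trans h'.1, h.2.trans h'.2, h.3.trans h'.3⟩

theorem cons (e : Pos) {s t : Multiset Pos} (h : PosEquiv s t) : PosEquiv (e ::ₘ s) (e ::ₘ t) :=
  ⟨by simp [h.1], by simp [h.2], by simp [h.3]⟩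

theorem symm_cons (r q : Fin 4) (i : Fin 2) (s : Multiset Pos) :
    PosEquiv ((r, some (i, q)) ::ₘ s) ((q, some (i, r)) ::ₘ s) :=
  ⟨by simp [posVar_symm r q i], by simp [posRows, Multiset.pair_comm r q], by simp⟩

theorem swap_cons (r r' : Fin 4) (c c' : Option (Fin 2 × Fin 4)) (s : Multiset Pos) :
    PosEquiv ((r, c) ::ₘ (r', c') ::ₘ s) ((r', c) ::ₘ (r, c') ::ₘ s) where
  prod := by simp only [posProd_cons, ← mul_assoc, mk_posVar_mul_swap r r' c c']
  rows := by
    simp only [rowsOf_cons, ← add_assoc]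
    congr 1
    rcases c with _ | ⟨i, q⟩ <;> rcases c' with _ | ⟨i', q'⟩ <;> ext a <;>
      simp only [posRows, Multiset.insert_eq_cons, Multiset.count_add, Multiset.count_cons,
        Multiset.count_singleton] <;> ring
  twists := by simp

theorem exists_cons_of_mem_posRows {e : Pos} {r : Fin 4} (hr : r ∈ posRows e)
    (s : Multiset Pos) :
    ∃ c, c.map Prod.fst = e.2.map Prod.fst ∧ PosEquiv (e ::ₘ s) ((r, c) ::ₘ s) := by
  obtain ⟨a, _ | ⟨i, q⟩⟩ := e
  · obtain rfl : r = a := by simpa [posRows] using hr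
    exact ⟨none, rfl, refl _⟩
  · obtain rfl | rfl : r = a ∨ r = q := by simpa [posRows] using hr
    · exact ⟨_, rfl, refl _⟩
    · exact ⟨some (i, a), rfl, symm_cons ..⟩

theorem exists_cons_of_mem_rowsOf {s : Multiset Pos} {r : Fin 4} (hr : r ∈ rowsOf s) :
    ∃ c t, PosEquiv s ((r, c) ::ₘ t) := by
  obtain ⟨e, he, hre⟩ := Multiset.mem_bind.mp hr
  obtain ⟨t, rfl⟩ := Multiset.exists_cons_of_mem he
  obtain ⟨c, -, h⟩ := exists_cons_of_mem_posRows hre t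
  exact ⟨c, t, h⟩

theorem exists_cons_of_mem_of_mem {s : Multiset Pos} {r : Fin 4} {τ : Option (Fin 2)}
    (hτ : τ ∈ twistsOf s) (hr : r ∈ rowsOf s) :
    ∃ c t, c.map Prod.fst = τ ∧ PosEquiv s ((r, c) ::ₘ t) := by
  obtain ⟨⟨a, c⟩, he, rfl⟩ := Multiset.mem_map.mp hτ
  obtain ⟨s, rfl⟩ := Multiset.exists_cons_of_mem he
  rw [rowsOf_cons, Multiset.mem_add] at hr
  obtain hr | hr := hr
  · obtain ⟨c', hc', h⟩ := exists_cons_of_mem_posRows hr s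
    exact ⟨c', s, hc', h⟩
  · obtain ⟨c', t, h⟩ := exists_cons_of_mem_rowsOf hr
    exact ⟨c, _, rfl, (h.cons _).trans (swap_cons ..)⟩

theorem exists_cons_of_pair_le {s : Multiset Pos} {r q : Fin 4} {i : Fin 2}
    (hi : some i ∈ twistsOf s) (hrq : {r, q} ≤ rowsOf s) :
    ∃ t, PosEquiv s ((r, some (i, q)) ::ₘ t) := by
  obtain ⟨c, t, hc, h⟩ := exists_cons_of_mem_of_mem hi
    (Multiset.mem_of_le hrq (Multiset.mem_cons_self ..))
  obtain ⟨⟨_, q'⟩, rfl, rfl⟩ := Option.map_eq_some_iff.mp hc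
  rw [h.rows, rowsOf_cons, posRows, Multiset.insert_eq_cons, Multiset.insert_eq_cons,
    Multiset.cons_add, Multiset.cons_le_cons_iff, Multiset.singleton_add,
    Multiset.singleton_le, Multiset.mem_cons] at hrq
  obtain rfl | hq := hrq
  · exact ⟨t, h⟩
  · obtain ⟨c', u, hu⟩ := exists_cons_of_mem_rowsOf hq
    exact ⟨_, ((h.trans (hu.cons _)).trans (symm_cons ..)).trans
      ((swap_cons ..).trans (symm_cons ..))⟩

end PosEquiv

theorem posProd_eq_of_rowsOf_eq {s t : Multiset Pos} (hrows : rowsOf s = rowsOf t)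
    (htwists : twistsOf s = twistsOf t) : posProd s = posProd t := by
  induction s using Multiset.induction generalizing t with
  | empty =>
    obtain rfl : t = 0 := by simpa [twistsOf, eq_comm] using htwists
    rfl
  | cons e s ih =>
    obtain ⟨u, hu⟩ : ∃ u, PosEquiv t (e ::ₘ u) := by
      obtain ⟨r, _ | ⟨i, q⟩⟩ := e
      · obtain ⟨c, u, hc, hu⟩ := PosEquiv.exists_cons_of_mem_of_mem (s := t) (r := r) (τ := none)
          (by rw [← htwists]; simp) (by rw [← hrows]; simp [posRows])
        obtain rfl : c = none := by simpa using hc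
        exact ⟨u, hu⟩
      · exact PosEquiv.exists_cons_of_pair_le (by rw [← htwists]; simp)
          (by rw [← hrows, rowsOf_cons]; exact Multiset.le_add_right ..)
    rw [hu.prod, posProd_cons, posProd_cons, ih (t := u)]
    · simpa [hu.rows] using hrows
    · simpa [hu.twists] using htwists

/-- The exponents of `t₁, t₂, x₂, x₃, x₄` in the product of the monomials labelling a multiset
of positions. -/
noncomputable def posExponent (s : Multiset Pos) : Fin 5 →₀ ℕ :=
  Finsupp.equivFunOnFinite.symm
    ![(rowsOf s).count 2 + (twistsOf s).count (some 0),
      (rowsOf s).count 3 + (twistsOf s).count (some 1),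
      (rowsOf s).count 0, (rowsOf s).count 1, (rowsOf s).count 2 + (rowsOf s).count 3]

theorem posExponent_add (s t : Multiset Pos) :
    posExponent (s + t) = posExponent s + posExponent t := by
  ext k
  fin_cases k <;> simp [posExponent, rowsOf, twistsOf, Multiset.add_bind] <;> ring

theorem posExponent_eq_iff {s t : Multiset Pos} : posExponent s = posExponent t ↔
    ((rowsOf s).count 2 + (twistsOf s).count (some 0) =
      (rowsOf t).count 2 + (twistsOf t).count (some 0)) ∧
    ((rowsOf s).count 3 + (twistsOf s).count (some 1) =
      (rowsOf t).count 3 + (twistsOf t).count (some 1)) ∧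
    (rowsOf s).count 0 = (rowsOf t).count 0 ∧ (rowsOf s).count 1 = (rowsOf t).count 1 ∧
    (rowsOf s).count 2 + (rowsOf s).count 3 = (rowsOf t).count 2 + (rowsOf t).count 3 := by
  simp [posExponent]

theorem sum_count_rowsOf (s : Multiset Pos) :
    (rowsOf s).count 0 + (rowsOf s).count 1 + (rowsOf s).count 2 + (rowsOf s).count 3 =
      (twistsOf s).count none + 2 * (twistsOf s).count (some 0) +
        2 * (twistsOf s).count (some 1) := by
  induction s using Multiset.induction with
  | empty => simp [rowsOf, twistsOf]
  | cons e s ih =>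
    have h : ∀ e : Pos, (posRows e).count 0 + (posRows e).count 1 + (posRows e).count 2 +
        (posRows e).count 3 = ({e.2.map Prod.fst} : Multiset (Option (Fin 2))).count none +
          2 * ({e.2.map Prod.fst} : Multiset (Option (Fin 2))).count (some 0) +
          2 * ({e.2.map Prod.fst} : Multiset (Option (Fin 2))).count (some 1) := by decide
    have := h e
    rw [rowsOf_cons, twistsOf_cons, ← Multiset.singleton_add]
    simp only [Multiset.count_add]
    omega

theorem posProd_eq_of_count_eq_add {s t : Multiset Pos} (h : posExponent s = posExponent t)
    {n : ℕ} (hn : (rowsOf s).count 2 = (rowsOf t).count 2 + n) : posProd s = posProd t := by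
  induction n generalizing s with
  | zero =>
    have hs := sum_count_rowsOf s
    have ht := sum_count_rowsOf t
    obtain ⟨h0, h1, h2, h3, h4⟩ := posExponent_eq_iff.mp h
    apply posProd_eq_of_rowsOf_eq
    · ext r
      fin_cases r <;> simp only [Fin.reduceFinMk, Fin.mk_one, Fin.zero_eta] <;> omega
    · ext τ
      match τ with
      | none => omega
      | some 0 => omega
      | some 1 => omega
  | succ n ih =>
    have hs := posExponent_eq_iff.mp h
    obtain ⟨c, u, hc, hu⟩ := PosEquiv.exists_cons_of_mem_of_mem (s := s) (r := 2) (τ := some 1)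
      (Multiset.count_pos.mp (by omega)) (Multiset.count_pos.mp (by omega))
    obtain ⟨⟨_, q⟩, rfl, rfl⟩ := Option.map_eq_some_iff.mp hc
    rw [hu.prod, posProd_cons, posVar_two_one, ← posProd_cons]
    have hsu : (rowsOf s).count 2 =
        (rowsOf ((3, some (0, q)) ::ₘ u)).count 2 + 1 := by
      simp [hu.rows, posRows, Multiset.count_cons]
    refine ih ?_ (by omega)
    rw [← h, posExponent_eq_iff, hu.rows, hu.twists]
    simp [posRows, Multiset.count_cons]
    omega

theorem posProd_eq_of_posExponent_eq {s t : Multiset Pos} (h : posExponent s = posExponent t) :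
    posProd s = posProd t := by
  obtain hle | hle := le_total ((rowsOf t).count 2) ((rowsOf s).count 2)
  · exact posProd_eq_of_count_eq_add h (Nat.add_sub_of_le hle).symm
  · exact (posProd_eq_of_count_eq_add h.symm (Nat.add_sub_of_le hle).symm).symm

/-- The exponents of `t₁, t₂, x₂, x₃, x₄` in the monomial `w`. -/
noncomputable def labelExponent (w : Lam) : Fin 5 →₀ ℕ :=
  Finsupp.equivFunOnFinite.symm
    ![w.1.1, w.1.2.1, ({w.1.2.2.1, w.1.2.2.2} : Multiset (Fin 4)).count 1,
      ({w.1.2.2.1, w.1.2.2.2} : Multiset (Fin 4)).count 2,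
      ({w.1.2.2.1, w.1.2.2.2} : Multiset (Fin 4)).count 3]

/-- The map `ψ₀` followed by the substitution `x₁ = 1`. -/
noncomputable def dehomPsi : R0 →ₐ[ℂ] MvPolynomial (Fin 5) ℂ :=
  aeval fun w => monomial (labelExponent w) 1

theorem dehomPsi_posVar (e : Pos) : dehomPsi (posVar e) = monomial (posExponent {e}) 1 := by
  have h : ∀ (e : Pos) (k : Fin 5), labelExponent (entryLabel e.1 (colIndex e.2)) k =
      posExponent {e} k := by
    unfold labelExponent posExponent
    simp only [Finsupp.equivFunOnFinite_symm_apply_apply]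
    decide +kernel
  rw [posVar, M0_apply, dehomPsi, aeval_X, Finsupp.ext (h e)]

theorem posExponent_zero : posExponent 0 = 0 := by
  ext k
  fin_cases k <;> simp [posExponent, rowsOf, twistsOf]

theorem exists_multiset_of_monomial (u : Lam →₀ ℕ) :
    ∃ s, Ideal.Quotient.mk _ (monomial u 1) = posProd s ∧
      dehomPsi (monomial u 1) = monomial (posExponent s) 1 := by
  induction u using Finsupp.induction_linear with
  | zero => exact ⟨0, by simp [posProd], by simp [posExponent_zero]⟩
  | add u v hu hv =>
    obtain ⟨s, hs, hs'⟩ := hu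
    obtain ⟨t, ht, ht'⟩ := hv
    have h : (monomial (u + v) 1 : R0) = monomial u 1 * monomial v 1 := by
      rw [monomial_mul, one_mul]
    refine ⟨s + t, ?_, ?_⟩
    · rw [h, map_mul, hs, ht, posProd, posProd, posProd, Multiset.map_add, Multiset.prod_add]
    · rw [h, map_mul, hs', ht', posExponent_add, monomial_mul, one_mul]
  | single w n =>
    obtain ⟨e, he⟩ := exists_posVar_eq w
    have h : (monomial (Finsupp.single w n) 1 : R0) = posVar e ^ n := by
      rw [he, X_pow_eq_monomial]
    refine ⟨Multiset.replicate n e, ?_, ?_⟩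
    · rw [h, map_pow, posProd, Multiset.map_replicate, Multiset.prod_replicate]
    · rw [h, map_pow, dehomPsi_posVar]
      clear h
      induction n with
      | zero => simp [posExponent_zero]
      | succ n ih =>
        rw [pow_succ', ih, monomial_mul, one_mul, Multiset.replicate_succ,
          ← Multiset.singleton_add, posExponent_add]

theorem minors2_M0_le_ker : minors2 M0 ≤ RingHom.ker dehomPsi := by
  have hsurj : Function.Surjective colIndex := by decide
  rw [minors2, Ideal.span_le]
  rintro _ ⟨r, r', j, j', rfl⟩
  obtain ⟨c, rfl⟩ := hsurj j
  obtain ⟨c', rfl⟩ := hsurj j'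
  have h (r c) : M0 r (colIndex c) = posVar (r, c) := rfl
  simp only [h, SetLike.mem_coe, RingHom.mem_ker, map_sub, map_mul, dehomPsi_posVar,
    monomial_mul, ← posExponent_add, Multiset.singleton_add, sub_eq_zero]
  congr 2
  have := PosEquiv.swap_cons r r' c c' 0
  rw [Multiset.cons_zero, Multiset.cons_zero] at this
  rw [← Multiset.singleton_add (r, c'), add_comm, Multiset.singleton_add, posExponent, posExponent,
    this.rows, this.twists]

theorem ker_dehomPsi : RingHom.ker dehomPsi = minors2 M0 := by
  refine le_antisymm (fun f hf => ?_) minors2_M0_le_ker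
  classical
  let τ : MvPolynomial (Fin 5) ℂ →ₗ[ℂ] R0 ⧸ minors2 M0 :=
    (basisMonomials (Fin 5) ℂ).constr ℂ fun m =>
      if h : ∃ s, posExponent s = m then posProd h.choose else 0
  have hτ (s : Multiset Pos) : τ (monomial (posExponent s) 1) = posProd s := by
    have h : ∃ t, posExponent t = posExponent s := ⟨s, rfl⟩
    have hm : (monomial (posExponent s) 1 : MvPolynomial (Fin 5) ℂ) =
      basisMonomials (Fin 5) ℂ (posExponent s) := by simp
    rw [hm, Module.Basis.constr_basis, dif_pos h]
    exact posProd_eq_of_posExponent_eq h.choose_spec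
  have hcomp : τ ∘ₗ dehomPsi.toLinearMap = (Ideal.Quotient.mkₐ ℂ (minors2 M0)).toLinearMap := by
    refine (basisMonomials Lam ℂ).ext fun u => ?_
    obtain ⟨s, hs, hs'⟩ := exists_multiset_of_monomial u
    simp [coe_basisMonomials, hs, hs', hτ]
  have := LinearMap.congr_fun hcomp f
  rw [RingHom.mem_ker] at hf
  rw [← Ideal.Quotient.eq_zero_iff_mem]
  simpa [hf] using this.symm

theorem monomial_mem_range_dehomPsi (e : Pos) :
    monomial (posExponent {e}) 1 ∈ dehomPsi.range :=
  ⟨posVar e, dehomPsi_posVar e⟩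

theorem monomial_posExponent (s : Multiset Pos) :
    (monomial (posExponent s) 1 : MvPolynomial (Fin 5) ℂ) =
    X 0 ^ ((rowsOf s).count 2 + (twistsOf s).count (some 0)) *
      X 1 ^ ((rowsOf s).count 3 + (twistsOf s).count (some 1)) *
      X 2 ^ (rowsOf s).count 0 * X 3 ^ (rowsOf s).count 1 *
      X 4 ^ ((rowsOf s).count 2 + (rowsOf s).count 3) := by
  rw [monomial_eq, Finsupp.prod_fintype _ _ (by simp)]
  simp [posExponent, Fin.prod_univ_five]

theorem isAlgebraic_range_dehomPsi :
    Algebra.IsAlgebraic dehomPsi.range (MvPolynomial (Fin 5) ℂ) := by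
  have hpos (e : Pos) : IsAlgebraic dehomPsi.range
      (monomial (posExponent {e}) 1 : MvPolynomial (Fin 5) ℂ) :=
    isAlgebraic_algebraMap (⟨_, monomial_mem_range_dehomPsi e⟩ : dehomPsi.range)
  have hX (k : Fin 5) : (X k : MvPolynomial (Fin 5) ℂ) ∈ nonZeroDivisors _ :=
    mem_nonZeroDivisors_of_ne_zero (X_ne_zero k)
  have h2 : IsAlgebraic dehomPsi.range (X 2 : MvPolynomial (Fin 5) ℂ) := by
    have := hpos (0, none)
    simpa [monomial_posExponent, rowsOf, twistsOf, posRows] using this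
  have h3 : IsAlgebraic dehomPsi.range (X 3 : MvPolynomial (Fin 5) ℂ) := by
    have := hpos (1, none)
    simpa [monomial_posExponent, rowsOf, twistsOf, posRows] using this
  have h0 : IsAlgebraic dehomPsi.range (X 0 : MvPolynomial (Fin 5) ℂ) := by
    have := hpos (0, some (0, 0))
    refine IsAlgebraic.of_mul (pow_mem (hX 2) 2) (h2.pow 2) ?_
    simpa [monomial_posExponent, rowsOf, twistsOf, posRows, mul_comm] using this
  have h1 : IsAlgebraic dehomPsi.range (X 1 : MvPolynomial (Fin 5) ℂ) := by
    have := hpos (0, some (1, 0))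
    refine IsAlgebraic.of_mul (pow_mem (hX 2) 2) (h2.pow 2) ?_
    simpa [monomial_posExponent, rowsOf, twistsOf, posRows, mul_comm] using this
  have h4 : IsAlgebraic dehomPsi.range (X 4 : MvPolynomial (Fin 5) ℂ) := by
    have := hpos (2, none)
    refine IsAlgebraic.of_mul (hX 0) h0 ?_
    simpa [monomial_posExponent, rowsOf, twistsOf, posRows] using this
  refine ⟨fun f => ?_⟩
  induction f using MvPolynomial.induction_on with
  | C a => exact isAlgebraic_algebraMap (algebraMap ℂ dehomPsi.range a)
  | add p q hp hq => exact hp.add hq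
  | mul_X p k hp =>
    refine hp.mul ?_
    fin_cases k
    exacts [h0, h1, h2, h3, h4]

/-- The ideal of `R₀` generated by the `2 × 2` minors of `M₀` is prime, and
the quotient ring has Krull dimension `5` (the affine cone over the 4-dimensional irreducible
projective variety `Q ⊂ ℙ¹⁹`). -/
theorem minors2_M0_prime_and_dim :
    (minors2 M0).IsPrime ∧ ringKrullDim (R0 ⧸ minors2 M0) = 5 := by
  rw [← ker_dehomPsi]
  refine ⟨RingHom.ker_isPrime _, ?_⟩
  have hfin : Finite Lam := by
    choose e he using exists_posVar_eq
    refine Finite.of_injective e fun w w' h => X_injective (R := ℂ) ?_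
    rw [← he w, ← he w', h]
  rw [ringKrullDim_eq_of_ringEquiv (Ideal.quotientKerEquivRange dehomPsi).toRingEquiv]
  have : Algebra.FiniteType ℂ dehomPsi.range :=
    Algebra.FiniteType.of_surjective dehomPsi.rangeRestrict dehomPsi.rangeRestrict_surjective
  have := isAlgebraic_range_dehomPsi
  have htr := trdeg_add_eq ℂ dehomPsi.range (A := MvPolynomial (Fin 5) ℂ)
  rw [trdeg_eq_zero (R := dehomPsi.range), MvPolynomial.trdeg_of_isDomain] at htr
  exact ringKrullDim_eq_of_trdeg_eq (n := 5) ℂ _ (by simpa using htr)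
end
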